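/- arXiv:1711.00776 — 5 statements merged into one kernel-verified Lean document; each statement's English description precedes it below -/
import Mathlib

section
/- The function w : ℝ → ℝ defined by w(t) = c_n·(2·cosh t)^(−(n−4)/2) is a positive C⁴ solution of the ODE w''''(t) − A·w''(t) − f(w(t)) = 0 for all t ∈ ℝ, where A = (n(n−4)+8)/2. -/
open Real Filter

namespace Paper

/-- The coefficient `A = (n(n-4)+8)/2`. -/
noncomputable def A (n : ℕ) : ℝ := ((n : ℝ) * ((n : ℝ) - 4) + 8) / 2

/-- The coefficient `B = n²(n-4)²/16`. -/
noncomputable def B (n : ℕ) : ℝ := (n : ℝ) ^ 2 * ((n : ℝ) - 4) ^ 2 / 16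

/-- The exponent `p = (n+4)/(n-4)`. -/
noncomputable def p (n : ℕ) : ℝ := ((n : ℝ) + 4) / ((n : ℝ) - 4)

/-- The nonlinearity `f(v) = |v|^(p-1) v - B v`. -/
noncomputable def f (n : ℕ) (v : ℝ) : ℝ := |v| ^ (p n - 1) * v - B n * v

/-- The constant `a₀ = (n(n-4)/4)^((n-4)/4)`. -/
noncomputable def a₀ (n : ℕ) : ℝ := ((n : ℝ) * ((n : ℝ) - 4) / 4) ^ (((n : ℝ) - 4) / 4)

/-- The constant `c_n = ((n-4)(n-2)n(n+2))^((n-4)/8)`. -/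
noncomputable def c (n : ℕ) : ℝ :=
  (((n : ℝ) - 4) * ((n : ℝ) - 2) * (n : ℝ) * ((n : ℝ) + 2)) ^ (((n : ℝ) - 4) / 8)

/-- The potential `F(v) = |v|^(p+1)/(p+1) - (B/2) v²`. -/
noncomputable def F (n : ℕ) (s : ℝ) : ℝ := |s| ^ (p n + 1) / (p n + 1) - B n / 2 * s ^ 2

/-- The energy `E_v(t) = -v''' v' + v''²/2 + (A/2) v'² + F(v)`. -/
noncomputable def E (n : ℕ) (v : ℝ → ℝ) (t : ℝ) : ℝ :=
  -(iteratedDeriv 3 v t) * deriv v t + 1 / 2 * (iteratedDeriv 2 v t) ^ 2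
    + A n / 2 * (deriv v t) ^ 2 + F n (v t)

end Paper

/-- Powers of `2 cosh` are smooth. -/
lemma contDiff_two_mul_cosh_rpow (a : ℝ) {k : WithTop ℕ∞} :
    ContDiff ℝ k (fun t : ℝ => (2 * Real.cosh t) ^ a) :=
  (contDiff_const.mul Real.contDiff_cosh).rpow_const_of_ne fun t => by
    have := Real.cosh_pos t
    positivity

lemma hasDerivAt_two_mul_cosh_rpow (a t : ℝ) :
    HasDerivAt (fun s : ℝ => (2 * Real.cosh s) ^ a)
      (2 * Real.sinh t * a * (2 * Real.cosh t) ^ (a - 1)) t :=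
  ((Real.hasDerivAt_cosh t).const_mul 2).rpow_const
    (Or.inl (by have := Real.cosh_pos t; positivity))

/-- The second derivative of a power of `2 cosh` is a combination of two such powers. -/
lemma iteratedDeriv_two_two_mul_cosh_rpow (a : ℝ) :
    iteratedDeriv 2 (fun s : ℝ => (2 * Real.cosh s) ^ a) = fun t =>
      a ^ 2 * (2 * Real.cosh t) ^ a - 4 * a * (a - 1) * (2 * Real.cosh t) ^ (a - 2) := by
  have h1 : deriv (fun s : ℝ => (2 * Real.cosh s) ^ a) =
      fun t => 2 * Real.sinh t * a * (2 * Real.cosh t) ^ (a - 1) :=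
    funext fun t => (hasDerivAt_two_mul_cosh_rpow a t).deriv
  rw [iteratedDeriv_succ, iteratedDeriv_one, h1]
  funext t
  have hu : 0 < 2 * Real.cosh t := by have := Real.cosh_pos t; positivity
  have h2 := (((Real.hasDerivAt_sinh t).const_mul 2).mul_const a).mul
    (hasDerivAt_two_mul_cosh_rpow (a - 1) t)
  refine h2.deriv.trans ?_
  have e1 : (2 * Real.cosh t) ^ (a - 1) = (2 * Real.cosh t) ^ (a - 2) * (2 * Real.cosh t) := by
    rw [← Real.rpow_add_one hu.ne']; ring_nf
  have e2 : (2 * Real.cosh t) ^ a = (2 * Real.cosh t) ^ (a - 2) * (2 * Real.cosh t) ^ 2 := by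
    rw [← Real.rpow_natCast, ← Real.rpow_add hu]; norm_num
  have e3 : a - 1 - 1 = a - 2 := by ring
  rw [e3, e1, e2]
  linear_combination
    (-4 * a * (a - 1) * (2 * Real.cosh t) ^ (a - 2)) * Real.cosh_sq t

/-- The fourth derivative of a power of `2 cosh` is a combination of three such powers. -/
lemma iteratedDeriv_four_two_mul_cosh_rpow (a t : ℝ) :
    iteratedDeriv 4 (fun s : ℝ => (2 * Real.cosh s) ^ a) t =
      a ^ 4 * (2 * Real.cosh t) ^ a
        - 4 * a * (a - 1) * (a ^ 2 + (a - 2) ^ 2) * (2 * Real.cosh t) ^ (a - 2)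
        + 16 * a * (a - 1) * (a - 2) * (a - 3) * (2 * Real.cosh t) ^ (a - 4) := by
  have h : iteratedDeriv 4 (fun s : ℝ => (2 * Real.cosh s) ^ a) =
      iteratedDeriv 2 (iteratedDeriv 2 (fun s : ℝ => (2 * Real.cosh s) ^ a)) := by
    simp only [iteratedDeriv_eq_iterate]
    rfl
  rw [h, iteratedDeriv_two_two_mul_cosh_rpow,
    iteratedDeriv_fun_sub
      (contDiff_const.mul (contDiff_two_mul_cosh_rpow a)).contDiffAt
      (contDiff_const.mul (contDiff_two_mul_cosh_rpow (a - 2))).contDiffAt,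
    iteratedDeriv_const_mul_field, iteratedDeriv_const_mul_field,
    iteratedDeriv_two_two_mul_cosh_rpow, iteratedDeriv_two_two_mul_cosh_rpow]
  have e : a - 2 - 2 = a - 4 := by ring
  simp only [e]
  ring

/-- The explicit function `w(t) = c_n (2 cosh t)^(-(n-4)/2)` is a positive `C⁴` solution of
`w'''' - A w'' - f(w) = 0` on `ℝ`. -/
theorem cosh_is_solution (n : ℕ) (hn : 5 ≤ n) :
    (∀ t : ℝ, 0 < Paper.c n * (2 * Real.cosh t) ^ (-(((n : ℝ) - 4) / 2))) ∧
    ContDiff ℝ 4 (fun t : ℝ => Paper.c n * (2 * Real.cosh t) ^ (-(((n : ℝ) - 4) / 2))) ∧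
    ∀ t : ℝ,
      iteratedDeriv 4 (fun s : ℝ => Paper.c n * (2 * Real.cosh s) ^ (-(((n : ℝ) - 4) / 2))) t
        - Paper.A n *
          iteratedDeriv 2 (fun s : ℝ => Paper.c n * (2 * Real.cosh s) ^ (-(((n : ℝ) - 4) / 2))) t
        - Paper.f n (Paper.c n * (2 * Real.cosh t) ^ (-(((n : ℝ) - 4) / 2))) = 0 := by
  have hn' : (5 : ℝ) ≤ n := by exact_mod_cast hn
  have hn4 : (0 : ℝ) < n - 4 := by linarith
  have hn2 : (0 : ℝ) < n - 2 := by linarith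
  have hK : 0 < ((n : ℝ) - 4) * ((n : ℝ) - 2) * (n : ℝ) * ((n : ℝ) + 2) := by positivity
  have hc : 0 < Paper.c n := Real.rpow_pos_of_pos hK _
  have hu : ∀ t : ℝ, 0 < 2 * Real.cosh t := fun t => by have := Real.cosh_pos t; positivity
  have hpos : ∀ t : ℝ, 0 < Paper.c n * (2 * Real.cosh t) ^ (-(((n : ℝ) - 4) / 2)) :=
    fun t => mul_pos hc (Real.rpow_pos_of_pos (hu t) _)
  refine ⟨hpos, contDiff_const.mul (contDiff_two_mul_cosh_rpow _), fun t => ?_⟩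
  rw [iteratedDeriv_const_mul_field, iteratedDeriv_const_mul_field,
    iteratedDeriv_four_two_mul_cosh_rpow, iteratedDeriv_two_two_mul_cosh_rpow,
    Paper.f, abs_of_pos (hpos t)]
  have hp : Paper.p n - 1 = 8 / ((n : ℝ) - 4) := by
    rw [Paper.p]; field_simp; ring
  have hcp : Paper.c n ^ (Paper.p n - 1) =
      ((n : ℝ) - 4) * ((n : ℝ) - 2) * (n : ℝ) * ((n : ℝ) + 2) := by
    rw [hp, Paper.c, ← Real.rpow_mul hK.le, div_mul_div_cancel₀' hn4.ne', div_self (by norm_num),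
      Real.rpow_one]
  have hup : ((2 * Real.cosh t) ^ (-(((n : ℝ) - 4) / 2))) ^ (Paper.p n - 1) *
      (2 * Real.cosh t) ^ (-(((n : ℝ) - 4) / 2)) =
      (2 * Real.cosh t) ^ (-(((n : ℝ) - 4) / 2) - 4) := by
    rw [hp, ← Real.rpow_mul (hu t).le, ← Real.rpow_add (hu t)]
    congr 1
    field_simp
    ring
  rw [Real.mul_rpow hc.le (Real.rpow_pos_of_pos (hu t) _).le, hcp, Paper.A, Paper.B]
  linear_combination (-(((n : ℝ) - 4) * ((n : ℝ) - 2) * (n : ℝ) * ((n : ℝ) + 2)) * Paper.c n) * hup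
end

section
/- Let v ∈ C⁴(ℝ) be a solution of the ODE v'''' − A·v'' − f(v) = 0 on ℝ. Then v is not strictly monotone on ℝ; in fact, there exists t ∈ ℝ with v'(t) = 0. -/
open Real Filter

open Topology

/-- `v` solves `v'''' = a v'' + φ(v)` on `ℝ`, with first three derivatives `v₁`, `v₂`, `v₃`. -/
structure IsSolution (a : ℝ) (φ v v₁ v₂ v₃ : ℝ → ℝ) : Prop where
  deriv₀ : ∀ t, HasDerivAt v (v₁ t) t
  deriv₁ : ∀ t, HasDerivAt v₁ (v₂ t) t
  deriv₂ : ∀ t, HasDerivAt v₂ (v₃ t) t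
  deriv₃ : ∀ t, HasDerivAt v₃ (a * v₂ t + φ (v t)) t

/-- A function whose derivative is eventually bounded below by a positive constant tends to
infinity. -/
theorem tendsto_atTop_of_hasDerivAt_ge {w w' : ℝ → ℝ} (hw : ∀ t, HasDerivAt w (w' t) t) {k : ℝ}
    (hk : 0 < k) (h : ∀ᶠ t in atTop, k ≤ w' t) : Tendsto w atTop atTop := by
  obtain ⟨T, hT⟩ := eventually_atTop.1 h
  have hlin : Tendsto (fun t => k * (t - T) + w T) atTop atTop :=
    tendsto_atTop_add_const_right _ _
      ((tendsto_atTop_add_const_right _ (-T) tendsto_id).const_mul_atTop hk)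
  refine tendsto_atTop_mono' _ ?_ hlin
  filter_upwards [eventually_ge_atTop T] with t ht
  have := (convex_Ici T).mul_sub_le_image_sub_of_le_deriv (f := w) (C := k)
    (fun x _ => (hw x).continuousAt.continuousWithinAt)
    (fun x _ => (hw x).differentiableAt.differentiableWithinAt)
    (fun x hx => by
      rw [(hw x).deriv]
      exact hT x (interior_subset hx)) T Set.self_mem_Ici t ht ht
  linarith

theorem tendsto_atTop_of_hasDerivAt_atTop {w w' : ℝ → ℝ} (hw : ∀ t, HasDerivAt w (w' t) t)
    (h : Tendsto w' atTop atTop) : Tendsto w atTop atTop :=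
  tendsto_atTop_of_hasDerivAt_ge hw one_pos (h.eventually_ge_atTop 1)

/-- Integrating the differential inequality `G' ≥ k v ^ r v'` when `v` tends to infinity. -/
theorem exists_eventually_mul_rpow_le {v v' G G' : ℝ → ℝ} (hv : ∀ t, HasDerivAt v (v' t) t)
    (hG : ∀ t, HasDerivAt G (G' t) t) (hlim : Tendsto v atTop atTop) {k r : ℝ} (hk : 0 < k)
    (hr : 0 < r) (h : ∀ᶠ t in atTop, k * v t ^ r * v' t ≤ G' t) :
    ∃ k' > 0, ∀ᶠ t in atTop, k' * v t ^ (r + 1) ≤ G t := by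
  have hr1 : 0 < r + 1 := by linarith
  obtain ⟨T, hT⟩ := eventually_atTop.1 (h.and (hlim.eventually_gt_atTop 0))
  set H : ℝ → ℝ := fun t => k / (r + 1) * v t ^ (r + 1) with hH
  have hderiv : ∀ t, T ≤ t → HasDerivAt (fun t => G t - H t) (G' t - k * v t ^ r * v' t) t := by
    intro t ht
    have h1 := ((hv t).rpow_const (p := r + 1) (Or.inl (hT t ht).2.ne')).const_mul (k / (r + 1))
    refine ((hG t).sub h1).congr_deriv ?_
    rw [add_sub_cancel_right]
    field_simp
  have hmono : MonotoneOn (fun t => G t - H t) (Set.Ici T) := by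
    refine monotoneOn_of_deriv_nonneg (convex_Ici T)
      (fun x hx => (hderiv x hx).continuousAt.continuousWithinAt)
      (fun x hx => (hderiv x (interior_subset hx)).differentiableAt.differentiableWithinAt)
      fun x hx => ?_
    rw [(hderiv x (interior_subset hx)).deriv]
    linarith [(hT x (interior_subset hx)).1]
  have hHlim : Tendsto H atTop atTop :=
    ((tendsto_rpow_atTop hr1).comp hlim).const_mul_atTop (div_pos hk hr1)
  refine ⟨k / (r + 1) / 2, by positivity, ?_⟩
  filter_upwards [eventually_ge_atTop T, hHlim.eventually_ge_atTop (-2 * (G T - H T))] with t ht h2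
  have h3 : G T - H T ≤ G t - H t := hmono Set.self_mem_Ici ht ht
  have h4 : k / (r + 1) / 2 * v t ^ (r + 1) = H t / 2 := by simp only [hH]; ring
  linarith

/-- A positive function on a half-line cannot satisfy `v' ≥ k v ^ (1 + s)` with `s > 0`. -/
theorem not_eventually_mul_rpow_le_deriv {v v' : ℝ → ℝ} (hv : ∀ t, HasDerivAt v (v' t) t)
    (hlim : Tendsto v atTop atTop) {k s : ℝ} (hk : 0 < k) (hs : 0 < s) :
    ¬ ∀ᶠ t in atTop, k * v t ^ (1 + s) ≤ v' t := by
  intro h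
  obtain ⟨T, hT⟩ := eventually_atTop.1 (h.and (hlim.eventually_gt_atTop 0))
  have hderiv : ∀ t, T ≤ t →
      HasDerivAt (fun t => -(v t ^ (-s))) (s * v t ^ (-s - 1) * v' t) t := by
    intro t ht
    refine ((hv t).rpow_const (p := -s) (Or.inl (hT t ht).2.ne')).neg.congr_deriv ?_
    ring
  have hlow : ∀ t, T ≤ t → s * k ≤ s * v t ^ (-s - 1) * v' t := by
    intro t ht
    obtain ⟨h1, h0⟩ := hT t ht
    have h2 : v t ^ (-s - 1) * v t ^ (1 + s) = 1 := by
      rw [← Real.rpow_add h0, show -s - 1 + (1 + s) = 0 by ring, Real.rpow_zero]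
    have h3 : 0 < v t ^ (-s - 1) := Real.rpow_pos_of_pos h0 _
    calc s * k = s * v t ^ (-s - 1) * (k * v t ^ (1 + s)) := by linear_combination (-s * k) * h2
      _ ≤ _ := by gcongr
  set t := T + v T ^ (-s) / (s * k) with ht
  have hpos : 0 < v T ^ (-s) := Real.rpow_pos_of_pos (hT T le_rfl).2 _
  have hTt : T ≤ t := by
    have : 0 < v T ^ (-s) / (s * k) := by positivity
    linarith
  have hgrow := (convex_Ici T).mul_sub_le_image_sub_of_le_deriv (C := s * k)
    (fun x hx => (hderiv x hx).continuousAt.continuousWithinAt)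
    (fun x hx => (hderiv x (interior_subset hx)).differentiableAt.differentiableWithinAt)
    (fun x hx => by
      rw [(hderiv x (interior_subset hx)).deriv]
      exact hlow x (interior_subset hx)) T Set.self_mem_Ici t hTt hTt
  have h5 : s * k * (t - T) = v T ^ (-s) := by
    rw [ht]
    field_simp
    ring
  have h6 : 0 < v t ^ (-s) := Real.rpow_pos_of_pos (hT t hTt).2 _
  linarith

namespace IsSolution

variable {a : ℝ} {φ v v₁ v₂ v₃ : ℝ → ℝ}

theorem neg (h : IsSolution a φ v v₁ v₂ v₃) (hodd : ∀ x, φ (-x) = -φ x) :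
    IsSolution a φ (fun t => -v t) (fun t => -v₁ t) (fun t => -v₂ t) (fun t => -v₃ t) where
  deriv₀ t := (h.deriv₀ t).neg
  deriv₁ t := (h.deriv₁ t).neg
  deriv₂ t := (h.deriv₂ t).neg
  deriv₃ t := (h.deriv₃ t).neg.congr_deriv (by rw [hodd]; ring)

/-- The point reflection `t ↦ -v (-t)` of a solution is a solution. -/
theorem reflect (h : IsSolution a φ v v₁ v₂ v₃) (hodd : ∀ x, φ (-x) = -φ x) :
    IsSolution a φ (fun t => -v (-t)) (fun t => v₁ (-t)) (fun t => -v₂ (-t))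
      (fun t => v₃ (-t)) where
  deriv₀ t := ((h.deriv₀ (-t)).comp t (hasDerivAt_neg t)).neg.congr_deriv (by ring)
  deriv₁ t := ((h.deriv₁ (-t)).comp t (hasDerivAt_neg t)).congr_deriv (by ring)
  deriv₂ t := ((h.deriv₂ (-t)).comp t (hasDerivAt_neg t)).neg.congr_deriv (by ring)
  deriv₃ t := ((h.deriv₃ (-t)).comp t (hasDerivAt_neg t)).congr_deriv (by rw [hodd]; ring)

theorem hasDerivAt_aux (h : IsSolution a φ v v₁ v₂ v₃) (t : ℝ) :
    HasDerivAt (fun t => v₂ t - a * v t) (v₃ t - a * v₁ t) t :=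
  (h.deriv₂ t).sub ((h.deriv₀ t).const_mul a)

theorem hasDerivAt_aux' (h : IsSolution a φ v v₁ v₂ v₃) (t : ℝ) :
    HasDerivAt (fun t => v₃ t - a * v₁ t) (φ (v t)) t :=
  ((h.deriv₃ t).sub ((h.deriv₁ t).const_mul a)).congr_deriv (by ring)

/-- A convergent solution cannot have second derivative eventually bounded below by a positive
constant. -/
theorem not_eventually_le_deriv₂ (h : IsSolution a φ v v₁ v₂ v₃) {L : ℝ}
    (hL : Tendsto v atTop (𝓝 L)) {k : ℝ} (hk : 0 < k) : ¬ ∀ᶠ t in atTop, k ≤ v₂ t := fun hev =>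
  not_tendsto_nhds_of_tendsto_atTop (tendsto_atTop_of_hasDerivAt_atTop h.deriv₀
    (tendsto_atTop_of_hasDerivAt_ge h.deriv₁ hk hev)) L hL

theorem not_tendsto_aux_atTop (h : IsSolution a φ v v₁ v₂ v₃) {L : ℝ}
    (hL : Tendsto v atTop (𝓝 L)) : ¬ Tendsto (fun t => v₂ t - a * v t) atTop atTop := by
  intro hy
  have h2 : Tendsto (fun t => (v₂ t - a * v t) + a * v t) atTop atTop :=
    hy.atTop_add (hL.const_mul a)
  simp only [sub_add_cancel] at h2
  exact h.not_eventually_le_deriv₂ hL one_pos (h2.eventually_ge_atTop 1)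

theorem apply_limit_nonpos (h : IsSolution a φ v v₁ v₂ v₃) (hφ : Continuous φ) {L : ℝ}
    (hL : Tendsto v atTop (𝓝 L)) : φ L ≤ 0 := by
  by_contra! hpos
  have hlim : Tendsto (fun t => φ (v t)) atTop (𝓝 (φ L)) := (hφ.tendsto L).comp hL
  exact h.not_tendsto_aux_atTop hL (tendsto_atTop_of_hasDerivAt_atTop h.hasDerivAt_aux
    (tendsto_atTop_of_hasDerivAt_ge h.hasDerivAt_aux' (half_pos hpos)
      (hlim.eventually_const_le (half_lt_self hpos))))

/-- The limit of a convergent solution is an equilibrium. -/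
theorem apply_limit_eq_zero (h : IsSolution a φ v v₁ v₂ v₃) (hφ : Continuous φ)
    (hodd : ∀ x, φ (-x) = -φ x) {L : ℝ} (hL : Tendsto v atTop (𝓝 L)) : φ L = 0 := by
  have h1 := h.apply_limit_nonpos hφ hL
  have h2 := (h.neg hodd).apply_limit_nonpos hφ hL.neg
  rw [hodd] at h2
  linarith

/-- If `v'' - a v` is concave on `[T, ∞)` and `v` converges to `L`, then `v'' - a v` lies below
its limit `-a L` at `T`. -/
theorem deriv₂_le (h : IsSolution a φ v v₁ v₂ v₃) (hodd : ∀ x, φ (-x) = -φ x) {L T : ℝ}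
    (hL : Tendsto v atTop (𝓝 L)) (hneg : ∀ t, T ≤ t → φ (v t) ≤ 0) :
    v₂ T ≤ a * (v T - L) := by
  by_contra! hlt
  have hanti : AntitoneOn (fun t => v₃ t - a * v₁ t) (Set.Ici T) := by
    refine antitoneOn_of_deriv_nonpos (convex_Ici T)
      (fun x _ => (h.hasDerivAt_aux' x).continuousAt.continuousWithinAt)
      (fun x _ => (h.hasDerivAt_aux' x).differentiableAt.differentiableWithinAt) fun x hx => ?_
    rw [(h.hasDerivAt_aux' x).deriv]
    exact hneg x (interior_subset hx)
  have hnonneg : ∀ s, T ≤ s → 0 ≤ v₃ s - a * v₁ s := by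
    intro s hs
    by_contra! hs0
    refine (h.neg hodd).not_tendsto_aux_atTop hL.neg
      (tendsto_atTop_of_hasDerivAt_ge (h.neg hodd).hasDerivAt_aux (neg_pos.2 hs0) ?_)
    filter_upwards [eventually_ge_atTop s] with t ht
    have : v₃ t - a * v₁ t ≤ v₃ s - a * v₁ s := hanti hs (hs.trans ht) ht
    linarith
  have hmono : MonotoneOn (fun t => v₂ t - a * v t) (Set.Ici T) := by
    refine monotoneOn_of_deriv_nonneg (convex_Ici T)
      (fun x _ => (h.hasDerivAt_aux x).continuousAt.continuousWithinAt)
      (fun x _ => (h.hasDerivAt_aux x).differentiableAt.differentiableWithinAt) fun x hx => ?_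
    rw [(h.hasDerivAt_aux x).deriv]
    exact hnonneg x (interior_subset hx)
  have hpos : 0 < v₂ T - a * v T + a * L := by linarith
  have hlim : Tendsto (fun t => v₂ T - a * v T + a * v t) atTop (𝓝 (v₂ T - a * v T + a * L)) :=
    (hL.const_mul a).const_add _
  refine h.not_eventually_le_deriv₂ hL (half_pos hpos) ?_
  filter_upwards [hlim.eventually_const_le (half_lt_self hpos), eventually_ge_atTop T] with t ht hTt
  have : v₂ T - a * v T ≤ v₂ t - a * v t := hmono Set.self_mem_Ici hTt hTt
  linarith

/-- Superlinear growth of the nonlinearity forces finite-time blow-up, so that a global solution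
cannot tend to infinity. -/
theorem not_tendsto_atTop (h : IsSolution a φ v v₁ v₂ v₃) (ha : 0 < a) {k q : ℝ} (hk : 0 < k)
    (hq : 0 < q) (hgrow : ∀ᶠ x in atTop, k * x ^ (q + 1) ≤ φ x) : ¬ Tendsto v atTop atTop := by
  intro hv
  have hq1 : 0 < q + 1 := by linarith
  have hφv : ∀ᶠ t in atTop, k * v t ^ (q + 1) ≤ φ (v t) := hv.eventually hgrow
  have hφlim : Tendsto (fun t => φ (v t)) atTop atTop :=
    tendsto_atTop_mono' _ hφv (((tendsto_rpow_atTop hq1).comp hv).const_mul_atTop hk)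
  have hy₁ := tendsto_atTop_of_hasDerivAt_atTop h.hasDerivAt_aux' hφlim
  have hy := tendsto_atTop_of_hasDerivAt_atTop h.hasDerivAt_aux hy₁
  have hv₂ : Tendsto v₂ atTop atTop := by
    simpa using hy.atTop_add_atTop (hv.const_mul_atTop ha)
  have hv₁ := tendsto_atTop_of_hasDerivAt_atTop h.deriv₁ hv₂
  have hv₃ : Tendsto v₃ atTop atTop := by
    simpa using hy₁.atTop_add_atTop (hv₁.const_mul_atTop ha)
  have pos₁ := hv₁.eventually_gt_atTop 0
  have pos₂ := hv₂.eventually_gt_atTop 0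
  have pos₃ := hv₃.eventually_gt_atTop 0
  obtain ⟨k₁, hk₁, h₁⟩ := exists_eventually_mul_rpow_le (G := fun t => v₃ t * v₁ t) h.deriv₀
    (fun t => (h.deriv₃ t).mul (h.deriv₁ t)) hv hk hq1 (by
      filter_upwards [hφv, pos₁, pos₂, pos₃] with t ht p₁ p₂ p₃
      have : k * v t ^ (q + 1) * v₁ t ≤ φ (v t) * v₁ t := by gcongr
      have : 0 ≤ a * v₂ t * v₁ t := by positivity
      have : 0 ≤ v₃ t * v₂ t := by positivity
      linarith)
  obtain ⟨k₂, hk₂, h₂⟩ := exists_eventually_mul_rpow_le (G := fun t => v₂ t * v₁ t ^ 2)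
    (r := q + 1 + 1) h.deriv₀
    (fun t => (h.deriv₂ t).mul ((h.deriv₁ t).pow 2)) hv hk₁ (by linarith) (by
      filter_upwards [h₁, pos₁, pos₂] with t ht p₁ p₂
      have : k₁ * v t ^ (q + 1 + 1) * v₁ t ≤ v₃ t * v₁ t * v₁ t := by gcongr
      have : 0 ≤ v₂ t * v₁ t * v₂ t := by positivity
      push_cast
      simp only [Pi.pow_apply]
      linarith)
  obtain ⟨k₃, hk₃, h₃⟩ := exists_eventually_mul_rpow_le (G := fun t => v₁ t ^ 4)
    (r := q + 1 + 1 + 1) h.deriv₀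
    (fun t => (h.deriv₁ t).pow 4) hv hk₂ (by linarith) (by
      filter_upwards [h₂, pos₁, pos₂] with t ht p₁ p₂
      have : k₂ * v t ^ (q + 1 + 1 + 1) * v₁ t ≤ v₂ t * v₁ t ^ 2 * v₁ t := by gcongr
      have : 0 ≤ v₂ t * v₁ t ^ 3 := by positivity
      push_cast
      linarith)
  refine not_eventually_mul_rpow_le_deriv h.deriv₀ hv (k := k₃ ^ (4⁻¹ : ℝ)) (s := q / 4)
    (by positivity) (by positivity) ?_
  filter_upwards [h₃, pos₁, hv.eventually_gt_atTop 0] with t ht p₁ p₀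
  refine le_of_pow_le_pow_left₀ (n := 4) (by norm_num) p₁.le ?_
  refine le_of_eq_of_le ?_ ht
  rw [mul_pow, ← Real.rpow_natCast, ← Real.rpow_mul hk₃.le, ← Real.rpow_natCast (v t ^ _),
    ← Real.rpow_mul p₀.le]
  norm_num
  left
  ring_nf

/-- There is no strictly increasing global solution when the odd nonlinearity is bistable-like,
negative on `(0, b)` with zeros exactly at `0, ±b`, and superlinear. -/
theorem not_strictMono (h : IsSolution a φ v v₁ v₂ v₃) (ha : 0 < a) (hφ : Continuous φ)
    (hodd : ∀ x, φ (-x) = -φ x) {b : ℝ} (hb : 0 < b) (hneg : ∀ x, 0 < x → x < b → φ x < 0)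
    (hzero : ∀ x, φ x = 0 → x = 0 ∨ x = b ∨ x = -b) {k q : ℝ} (hk : 0 < k)
    (hq : 0 < q) (hgrow : ∀ᶠ x in atTop, k * x ^ (q + 1) ≤ φ x) : ¬ StrictMono v := by
  intro hmono
  have key : ∀ {w w₁ w₂ w₃ : ℝ → ℝ}, IsSolution a φ w w₁ w₂ w₃ → StrictMono w →
      ∃ L, Tendsto w atTop (𝓝 L) ∧ φ L = 0 ∧ ∀ t, w t < L := by
    intro w w₁ w₂ w₃ hw hwm
    rcases tendsto_atTop_of_monotone hwm.monotone with hinf | ⟨L, hL⟩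
    · exact absurd hinf (hw.not_tendsto_atTop ha hk hq hgrow)
    · exact ⟨L, hL, hw.apply_limit_eq_zero hφ hodd hL, fun t =>
        (hwm (lt_add_one t)).trans_le (hwm.monotone.ge_of_tendsto hL _)⟩
  -- a solution connecting `0` to `b` is impossible
  have noHalf : ∀ {w w₁ w₂ w₃ : ℝ → ℝ}, IsSolution a φ w w₁ w₂ w₃ →
      Tendsto w atTop (𝓝 b) → Tendsto (fun t => -w (-t)) atTop (𝓝 0) → (∀ t, 0 < w t) →
      (∀ t, w t < b) → False := by
    intro w w₁ w₂ w₃ hw hwb hw0 hpos hlt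
    have hle : ∀ T, w₂ T ≤ a * (w T - b) := fun T =>
      hw.deriv₂_le hodd hwb fun t _ => (hneg _ (hpos t) (hlt t)).le
    refine (hw.reflect hodd).not_eventually_le_deriv₂ hw0 (k := a * (b / 2)) (by positivity) ?_
    filter_upwards [hw0.eventually_const_lt (show -(b / 2) < 0 by linarith)] with t ht
    have h1 := hle (-t)
    have h2 : a * (b / 2) ≤ a * (b - w (-t)) := by
      gcongr
      linarith
    linarith
  have hrm : StrictMono fun t => -v (-t) := fun s t hst => neg_lt_neg (hmono (neg_lt_neg hst))
  obtain ⟨L, hL, hφL, hltL⟩ := key h hmono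
  obtain ⟨M, hM, hφM, hltM⟩ := key (h.reflect hodd) hrm
  have hgt : ∀ t, -M < v t := fun t => by
    have := hltM (-t)
    simp only [neg_neg] at this
    linarith
  have hlt := (hgt 0).trans (hltL 0)
  have hφ0 : φ 0 = 0 := by
    have := hodd 0
    rw [neg_zero] at this
    linarith
  have hnp : ∀ x, 0 ≤ x → x < b → φ x ≤ 0 := fun x hx hxb => by
    rcases hx.eq_or_lt with rfl | hx
    · exact hφ0.le
    · exact (hneg x hx hxb).le
  rcases hzero L hφL with rfl | rfl | rfl <;> rcases hzero M hφM with rfl | rfl | rfl <;>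
    try linarith
  · exact noHalf (h.reflect hodd) hM (by simpa using hL) (fun t => by linarith [hltL (-t)]) hltM
  · exact noHalf h hL hM (fun t => by simpa using hgt t) hltL
  · have hcont : Continuous v := continuous_iff_continuousAt.2 fun t => (h.deriv₀ t).continuousAt
    obtain ⟨s, hs⟩ := (hL.eventually_const_lt hb).exists
    obtain ⟨r, hr⟩ := (hM.eventually_const_lt hb).exists
    obtain ⟨T, hT⟩ := mem_range_of_exists_le_of_exists_ge hcont
      ⟨-r, show v (-r) ≤ 0 by linarith⟩ ⟨s, hs.le⟩
    have h1 := h.deriv₂_le hodd (T := T) hL fun t ht =>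
      hnp _ (hT ▸ hmono.monotone ht) (hltL t)
    have h2 := (h.reflect hodd).deriv₂_le hodd (T := -T) hM fun t ht =>
      hnp _ (by linarith [hmono.monotone (show -t ≤ T by linarith)]) (hltM t)
    simp only [neg_neg, hT] at h1 h2
    nlinarith

end IsSolution

namespace Paper

theorem f_neg (n : ℕ) (x : ℝ) : f n (-x) = -f n x := by
  simp only [f, abs_neg]
  ring

theorem p_sub_one_pos {n : ℕ} (hn : 5 ≤ n) : 0 < p n - 1 := by
  have h5 : (5 : ℝ) ≤ n := by exact_mod_cast hn
  have h1 : p n - 1 = 8 / ((n : ℝ) - 4) := by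
    have : (n : ℝ) - 4 ≠ 0 := by linarith
    unfold p
    field_simp
    ring
  rw [h1]
  exact div_pos (by norm_num) (by linarith)

theorem A_pos {n : ℕ} (hn : 5 ≤ n) : 0 < A n := by
  have h5 : (5 : ℝ) ≤ n := by exact_mod_cast hn
  unfold A
  nlinarith

theorem B_pos {n : ℕ} (hn : 5 ≤ n) : 0 < B n := by
  have h5 : (5 : ℝ) ≤ n := by exact_mod_cast hn
  have : (0 : ℝ) < n - 4 := by linarith
  unfold B
  positivity

theorem continuous_f {n : ℕ} (hn : 5 ≤ n) : Continuous (f n) := by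
  have := (p_sub_one_pos hn).le
  unfold f
  exact ((continuous_abs.rpow_const fun _ => Or.inr this).mul continuous_id).sub
    (continuous_const.mul continuous_id)

theorem f_eventually_ge {n : ℕ} (hn : 5 ≤ n) :
    ∀ᶠ x in atTop, 1 / 2 * x ^ (p n - 1 + 1) ≤ f n x := by
  filter_upwards [(tendsto_rpow_atTop (p_sub_one_pos hn)).eventually_ge_atTop (2 * B n),
    eventually_gt_atTop 0] with x hx hx0
  rw [f, abs_of_pos hx0, Real.rpow_add_one hx0.ne']
  nlinarith

theorem not_strictMono_of_isSolution {n : ℕ} (hn : 5 ≤ n) {v v₁ v₂ v₃ : ℝ → ℝ}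
    (h : IsSolution (A n) (f n) v v₁ v₂ v₃) : ¬ StrictMono v := by
  have hq := p_sub_one_pos hn
  have hB := B_pos hn
  have hb : 0 < B n ^ (p n - 1)⁻¹ := Real.rpow_pos_of_pos hB _
  refine h.not_strictMono (A_pos hn) (continuous_f hn) (f_neg n) hb ?_ ?_ one_half_pos hq
    (f_eventually_ge hn)
  · intro x hx hxb
    have h1 : x ^ (p n - 1) < B n := (Real.lt_rpow_inv_iff_of_pos hx.le hB.le hq).1 hxb
    rw [f, abs_of_pos hx]
    nlinarith
  · intro x hx
    have h1 : (|x| ^ (p n - 1) - B n) * x = 0 := by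
      rw [← hx, f]
      ring
    rcases mul_eq_zero.1 h1 with h2 | h2
    · right
      have h3 : |x| = B n ^ (p n - 1)⁻¹ :=
        (Real.eq_rpow_inv (abs_nonneg x) hB.le hq.ne').2 (sub_eq_zero.1 h2)
      exact (abs_eq hb.le).1 h3
    · exact Or.inl h2

end Paper

/-- No `C⁴` solution of `v'''' - A v'' - f(v) = 0` on `ℝ` is strictly monotone; in fact its
derivative vanishes somewhere. -/
theorem not_strictly_monotone (n : ℕ) (hn : 5 ≤ n) (v : ℝ → ℝ)
    (hreg : ContDiff ℝ 4 v)
    (hode : ∀ t : ℝ, iteratedDeriv 4 v t - Paper.A n * iteratedDeriv 2 v t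
      - Paper.f n (v t) = 0) :
    (¬ StrictMono v ∧ ¬ StrictAnti v) ∧ ∃ t : ℝ, deriv v t = 0 := by
  have hd : ∀ m : ℕ, m < 4 → ∀ t, HasDerivAt (iteratedDeriv m v) (iteratedDeriv (m + 1) v t) t := by
    intro m hm t
    rw [iteratedDeriv_succ]
    exact (hreg.differentiable_iteratedDeriv m (by exact_mod_cast hm) t).hasDerivAt
  have hsol : IsSolution (Paper.A n) (Paper.f n) v (deriv v) (iteratedDeriv 2 v)
      (iteratedDeriv 3 v) :=
    { deriv₀ := by simpa using hd 0 (by norm_num)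
      deriv₁ := by simpa using hd 1 (by norm_num)
      deriv₂ := hd 2 (by norm_num)
      deriv₃ := fun t => (hd 3 (by norm_num) t).congr_deriv (by linarith [hode t]) }
  have hmono := Paper.not_strictMono_of_isSolution hn hsol
  have hanti : ¬ StrictAnti v := fun hv =>
    Paper.not_strictMono_of_isSolution hn (hsol.neg (Paper.f_neg n)) hv.neg
  refine ⟨⟨hmono, hanti⟩, ?_⟩
  by_contra! hne
  have hcont : Continuous (deriv v) := hreg.continuous_deriv (by norm_num)
  by_cases hpos : ∀ t, 0 < deriv v t
  · exact hmono (strictMono_of_deriv_pos hpos)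
  by_cases hneg : ∀ t, deriv v t < 0
  · exact hanti (strictAnti_of_deriv_neg hneg)
  push Not at hpos hneg
  obtain ⟨T, hT⟩ := mem_range_of_exists_le_of_exists_ge hcont hpos hneg
  exact hne T hT
end

section
/- Let v ∈ C⁴(ℝ) be a bounded solution of the ODE v'''' − A·v'' − f(v) = 0 on ℝ. Then for all t ∈ ℝ the energy satisfies the pointwise inequality E_v(t) ≥ (1/2)·v''(t)² + F(v(t)), i.e. −v'''(t)·v'(t) + (A/2)·v'(t)² ≥ 0. -/
open Real Filter

open Set in
/-- A function with `w(0) = w''(0) = 0`, `w'(0) > 0` and `w'''(0) > a w'(0)` that satisfies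
`w'''' - 2a w'' + a² w ≥ 0` wherever `w ≥ 0` grows at least linearly on `[0, ∞)`. -/
theorem linear_growth_of_fourth_order_ineq {a : ℝ} (ha : 0 ≤ a) {w w₁ w₂ w₃ w₄ : ℝ → ℝ}
    (h₀ : ∀ s, HasDerivAt w (w₁ s) s) (h₁ : ∀ s, HasDerivAt w₁ (w₂ s) s)
    (h₂ : ∀ s, HasDerivAt w₂ (w₃ s) s) (h₃ : ∀ s, HasDerivAt w₃ (w₄ s) s)
    (hineq : ∀ s, 0 ≤ w s → 0 ≤ w₄ s - 2 * a * w₂ s + a ^ 2 * w s)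
    (hw : w 0 = 0) (hw₁ : 0 < w₁ 0) (hw₂ : w₂ 0 = 0) (hw₃ : a * w₁ 0 < w₃ 0) :
    ∀ s, 0 ≤ s → w₁ 0 * s ≤ w s := by
  have hz : ∀ s, HasDerivAt (fun s => w₂ s - a * w s) (w₃ s - a * w₁ s) s := fun s =>
    (h₂ s).sub ((h₀ s).const_mul a)
  have hz₁ : ∀ s, HasDerivAt (fun s => w₃ s - a * w₁ s) (w₄ s - a * w₂ s) s := fun s =>
    (h₃ s).sub ((h₁ s).const_mul a)
  have mono : ∀ (g g' : ℝ → ℝ) (b : ℝ), (∀ s, HasDerivAt g (g' s) s) →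
      (∀ s ∈ Ico 0 b, 0 ≤ g' s) → MonotoneOn g (Icc 0 b) := by
    intro g g' b hg hg'
    refine monotoneOn_of_deriv_nonneg (convex_Icc 0 b)
      (fun s _ => (hg s).continuousAt.continuousWithinAt)
      (fun s _ => (hg s).differentiableAt.differentiableWithinAt) fun s hs => ?_
    rw [interior_Icc] at hs
    rw [(hg s).deriv]
    exact hg' s (Ioo_subset_Ico_self hs)
  have step : ∀ b, 0 ≤ b → (∀ s ∈ Ico 0 b, 0 ≤ w₁ s ∧ 0 ≤ w₃ s - a * w₁ s) →
      w₁ 0 ≤ w₁ b ∧ w₃ 0 - a * w₁ 0 ≤ w₃ b - a * w₁ b := by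
    intro b hb h
    have h0 : (0 : ℝ) ∈ Icc 0 b := left_mem_Icc.2 hb
    have hbm : b ∈ Icc 0 b := right_mem_Icc.2 hb
    have wnn : ∀ s ∈ Ico 0 b, 0 ≤ w s := fun s hs => by
      have := mono w w₁ b h₀ (fun s hs => (h s hs).1) h0 (Ico_subset_Icc_self hs) hs.1
      rwa [hw] at this
    have znn : ∀ s ∈ Ico 0 b, 0 ≤ w₂ s - a * w s := fun s hs => by
      have := mono _ _ b hz (fun s hs => (h s hs).2) h0 (Ico_subset_Icc_self hs) hs.1
      simpa [hw, hw₂] using this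
    refine ⟨mono w₁ w₂ b h₁ (fun s hs => ?_) h0 hbm hb,
      mono _ _ b hz₁ (fun s hs => ?_) h0 hbm hb⟩
    · linarith [znn s hs, mul_nonneg ha (wnn s hs)]
    · linarith [hineq s (wnn s hs), mul_nonneg ha (znn s hs)]
  have pos : ∀ s, 0 ≤ s → 0 < w₁ s ∧ 0 < w₃ s - a * w₁ s := by
    by_contra! hcon
    obtain ⟨s₀, hs₀, hbad⟩ := hcon
    set S : Set ℝ := {s | 0 ≤ s ∧ min (w₁ s) (w₃ s - a * w₁ s) ≤ 0}
    have hclosed : IsClosed S := by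
      have c₁ : Continuous w₁ := continuous_iff_continuousAt.2 fun s => (h₁ s).continuousAt
      have c₃ : Continuous fun s => w₃ s - a * w₁ s :=
        continuous_iff_continuousAt.2 fun s => (hz₁ s).continuousAt
      exact (isClosed_le continuous_const continuous_id).inter
        (isClosed_le (c₁.min c₃) continuous_const)
    have hne : S.Nonempty := by
      refine ⟨s₀, hs₀, ?_⟩
      rcases le_or_gt (w₁ s₀) 0 with h | h
      · exact min_le_of_left_le h
      · exact min_le_of_right_le (hbad h)
    have hbdd : BddBelow S := ⟨0, fun s hs => hs.1⟩
    obtain ⟨hb, hmin⟩ := hclosed.csInf_mem hne hbdd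
    obtain ⟨k₁, k₂⟩ := step (sInf S) hb fun s hs => by
      have : s ∉ S := notMem_of_lt_csInf hs.2 hbdd
      have hlt : 0 < min (w₁ s) (w₃ s - a * w₁ s) := by
        by_contra hle
        exact this ⟨hs.1, not_lt.1 hle⟩
      exact ⟨(lt_min_iff.1 hlt).1.le, (lt_min_iff.1 hlt).2.le⟩
    exact absurd hmin (not_le.2 (lt_min (by linarith) (by linarith)))
  intro s hs
  have := mono (fun s => w s - w₁ 0 * s) (fun s => w₁ s - w₁ 0) s
    (fun s => ((h₀ s).sub ((hasDerivAt_id s).const_mul (w₁ 0))).congr_deriv (by simp))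
    (fun r hr => sub_nonneg.2
      (step r hr.1 fun q hq => ⟨(pos q hq.1).1.le, (pos q hq.1).2.le⟩).1)
    (left_mem_Icc.2 hs) (right_mem_Icc.2 hs) hs
  simp only [hw, mul_zero, sub_zero] at this
  linarith

theorem monotone_abs_rpow_mul_self {q : ℝ} (hq : 0 ≤ q) :
    Monotone fun x : ℝ => |x| ^ q * x := by
  intro x y hxy
  have key : ∀ {x y : ℝ}, 0 ≤ x → x ≤ y → |x| ^ q * x ≤ |y| ^ q * y := fun {x y} hx hxy => by
    have hle : |x| ^ q ≤ |y| ^ q :=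
      rpow_le_rpow (abs_nonneg x) (abs_le_abs_of_nonneg hx hxy) hq
    exact mul_le_mul hle hxy hx (rpow_nonneg (abs_nonneg y) q)
  rcases le_total 0 x with hx | hx
  · exact key hx hxy
  rcases le_total 0 y with hy | hy
  · exact (mul_nonpos_of_nonneg_of_nonpos (rpow_nonneg (abs_nonneg x) q) hx).trans
      (mul_nonneg (rpow_nonneg (abs_nonneg y) q) hy)
  · have := key (neg_nonneg.2 hy) (neg_le_neg hxy)
    simp only [abs_neg, mul_neg] at this
    exact neg_le_neg_iff.1 this

/-- For bounded solutions of `v'''' - 2a v'' + b v = g(v)` with `g` monotone and `b ≤ a²`,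
comparison with the reflected solution bounds `v'''` by `a v'` wherever `v' > 0`. -/
theorem third_deriv_le_of_bounded_solution {a b : ℝ} (ha : 0 ≤ a) (hb : b ≤ a ^ 2)
    {g : ℝ → ℝ} (hg : Monotone g) {v v₁ v₂ v₃ v₄ : ℝ → ℝ}
    (h₀ : ∀ s, HasDerivAt v (v₁ s) s) (h₁ : ∀ s, HasDerivAt v₁ (v₂ s) s)
    (h₂ : ∀ s, HasDerivAt v₂ (v₃ s) s) (h₃ : ∀ s, HasDerivAt v₃ (v₄ s) s)
    (hode : ∀ s, v₄ s - 2 * a * v₂ s + b * v s = g (v s))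
    {M : ℝ} (hM : ∀ s, |v s| ≤ M) {t : ℝ} (ht : 0 < v₁ t) : v₃ t ≤ a * v₁ t := by
  by_contra! hcon
  have hadd : ∀ {u u' : ℝ → ℝ}, (∀ s, HasDerivAt u (u' s) s) →
      ∀ s, HasDerivAt (fun s => u (t + s)) (u' (t + s)) s := fun h s =>
    (h (t + s)).comp_const_add t s
  have hsub : ∀ {u u' : ℝ → ℝ}, (∀ s, HasDerivAt u (u' s) s) →
      ∀ s, HasDerivAt (fun s => u (t - s)) (-u' (t - s)) s := fun h s =>
    (h (t - s)).comp_const_sub t s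
  have grow := linear_growth_of_fourth_order_ineq ha
    (w := fun s => v (t + s) - v (t - s)) (w₁ := fun s => v₁ (t + s) + v₁ (t - s))
    (w₂ := fun s => v₂ (t + s) - v₂ (t - s)) (w₃ := fun s => v₃ (t + s) + v₃ (t - s))
    (w₄ := fun s => v₄ (t + s) - v₄ (t - s))
    (fun s => ((hadd h₀ s).sub (hsub h₀ s)).congr_deriv (by ring))
    (fun s => ((hadd h₁ s).add (hsub h₁ s)).congr_deriv (by ring))
    (fun s => ((hadd h₂ s).sub (hsub h₂ s)).congr_deriv (by ring))
    (fun s => ((hadd h₃ s).add (hsub h₃ s)).congr_deriv (by ring))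
    (fun s hs => by
      have e₁ := hode (t + s)
      have e₂ := hode (t - s)
      have e₃ : g (v (t - s)) ≤ g (v (t + s)) := hg (sub_nonneg.1 hs)
      have e₄ : 0 ≤ (a ^ 2 - b) * (v (t + s) - v (t - s)) :=
        mul_nonneg (sub_nonneg.2 hb) hs
      linarith)
    (by simp) (by simpa using ht) (by simp) (by simp only [add_zero, sub_zero]; linarith)
  simp only [add_zero, sub_zero] at grow
  have hM0 : 0 ≤ M := (abs_nonneg _).trans (hM 0)
  have hbig := grow ((M + 1) / v₁ t) (by positivity)
  have heq : (v₁ t + v₁ t) * ((M + 1) / v₁ t) = 2 * (M + 1) := by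
    field_simp
    ring
  rw [heq] at hbig
  linarith [(abs_le.1 (hM (t + (M + 1) / v₁ t))).2, (abs_le.1 (hM (t - (M + 1) / v₁ t))).1]

/-- **Corollary 6 in [vdb].** For a bounded `C⁴` solution of `v'''' - A v'' - f(v) = 0`,
the energy dominates `v''²/2 + F(v)` pointwise, i.e. `-v''' v' + (A/2) v'² ≥ 0`. -/
theorem energy_pointwise_inequality (n : ℕ) (hn : 5 ≤ n) (v : ℝ → ℝ)
    (hreg : ContDiff ℝ 4 v)
    (hode : ∀ t : ℝ, iteratedDeriv 4 v t - Paper.A n * iteratedDeriv 2 v t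
      - Paper.f n (v t) = 0)
    (hbd : ∃ M : ℝ, ∀ t : ℝ, |v t| ≤ M) :
    ∀ t : ℝ, Paper.E n v t ≥ 1 / 2 * (iteratedDeriv 2 v t) ^ 2 + Paper.F n (v t) ∧
      -(iteratedDeriv 3 v t) * deriv v t + Paper.A n / 2 * (deriv v t) ^ 2 ≥ 0 := by
  have hn' : (5 : ℝ) ≤ n := by exact_mod_cast hn
  obtain ⟨M, hM⟩ := hbd
  have ha : 0 ≤ Paper.A n / 2 := by
    unfold Paper.A
    nlinarith
  have hb : Paper.B n ≤ (Paper.A n / 2) ^ 2 := by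
    unfold Paper.A Paper.B
    nlinarith [sq_nonneg ((n : ℝ) - 2)]
  have hq : 0 ≤ Paper.p n - 1 := by
    unfold Paper.p
    rw [sub_nonneg, one_le_div (by linarith)]
    linarith
  have hderiv : ∀ k < 4, ∀ s,
      HasDerivAt (iteratedDeriv k v) (iteratedDeriv (k + 1) v s) s := fun k hk s => by
    rw [iteratedDeriv_succ]
    exact (hreg.differentiable_iteratedDeriv k (by exact_mod_cast hk) s).hasDerivAt
  have h₀ : ∀ s, HasDerivAt v (deriv v s) s := by
    simpa [iteratedDeriv_one] using hderiv 0 (by norm_num)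
  have h₁ : ∀ s, HasDerivAt (deriv v) (iteratedDeriv 2 v s) s := by
    simpa only [iteratedDeriv_one] using hderiv 1 (by norm_num)
  have h₂ := hderiv 2 (by norm_num)
  have h₃ := hderiv 3 (by norm_num)
  have hode' : ∀ s, iteratedDeriv 4 v s - 2 * (Paper.A n / 2) * iteratedDeriv 2 v s
      + Paper.B n * v s = |v s| ^ (Paper.p n - 1) * v s := fun s => by
    have := hode s
    unfold Paper.f at this
    linarith
  have hg := monotone_abs_rpow_mul_self hq
  intro t
  have key : -(iteratedDeriv 3 v t) * deriv v t + Paper.A n / 2 * (deriv v t) ^ 2 ≥ 0 := by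
    rcases lt_trichotomy (deriv v t) 0 with ht | ht | ht
    · have := third_deriv_le_of_bounded_solution ha hb hg
        (fun s => (h₀ s).neg) (fun s => (h₁ s).neg) (fun s => (h₂ s).neg)
        (fun s => (h₃ s).neg)
        (fun s => by
          simp only [Pi.neg_apply, abs_neg]
          linarith [hode' s])
        (fun s => by simpa using hM s) (t := t) (by simpa using ht)
      nlinarith
    · simp [ht]
    · have := third_deriv_le_of_bounded_solution ha hb hg h₀ h₁ h₂ h₃ hode' hM ht
      nlinarith
  refine ⟨?_, key⟩
  unfold Paper.E
  linarith
end

section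
/- Let v ∈ C⁴(ℝ) be a positive solution of the ODE v'''' − A·v'' − f(v) = 0 on ℝ with lim_{|t|→∞} v(t) = 0 and v'(0) = 0. Then 0 is the only critical point of v and v'(t) < 0 for all t > 0; moreover the (constant) energy of v vanishes: E_v(t) = 0 for all t ∈ ℝ. -/
open Real Filter

namespace Paper

section Differential

/-- Mean value theorem in product form. -/
theorem exists_eq_deriv_mul {y y' : ℝ → ℝ} (h : ∀ t, HasDerivAt y (y' t) t) {s t : ℝ}
    (hst : s < t) : ∃ ξ ∈ Set.Ioo s t, y t - y s = y' ξ * (t - s) := by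
  obtain ⟨ξ, hξ, e⟩ := exists_hasDerivAt_eq_slope y y' hst
    (fun x _ => (h x).continuousAt.continuousWithinAt) (fun x _ => h x)
  refine ⟨ξ, hξ, ?_⟩
  rw [e, div_mul_cancel₀]
  linarith

theorem hasDerivAt_exp_mul {y y' : ℝ → ℝ} (h : ∀ t, HasDerivAt y (y' t) t) (k t : ℝ) :
    HasDerivAt (fun s => exp (-(k * s)) * y s) (exp (-(k * t)) * (y' t - k * y t)) t := by
  have h1 : HasDerivAt (fun s : ℝ => exp (-(k * s))) (exp (-(k * t)) * (-(k * 1))) t :=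
    (((hasDerivAt_id t).const_mul k).neg).exp
  exact (h1.mul (h t)).congr_deriv (by ring)

/-- A linear differential inequality `k y ≤ y'` propagates positivity. -/
theorem pos_of_deriv_ge {y y' : ℝ → ℝ} (h : ∀ t, HasDerivAt y (y' t) t) (k : ℝ) {T : ℝ}
    (hT : 0 ≤ T) (h0 : 0 < y 0) (hk : ∀ t ∈ Set.Ioo 0 T, k * y t ≤ y' t) : 0 < y T := by
  rcases hT.eq_or_lt with rfl | hT
  · exact h0
  obtain ⟨ξ, hξ, e⟩ := exists_eq_deriv_mul (hasDerivAt_exp_mul h k) hT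
  have h1 : 0 ≤ exp (-(k * ξ)) * (y' ξ - k * y ξ) * (T - 0) :=
    mul_nonneg (mul_nonneg (exp_pos _).le (sub_nonneg.2 (hk ξ hξ))) (by linarith)
  rw [← e] at h1
  simp only [mul_zero, neg_zero, exp_zero, one_mul] at h1
  have h2 : 0 < exp (-(k * T)) * y T := by linarith
  exact pos_of_mul_pos_right h2 (exp_pos _).le

/-- A strict linear differential inequality `k y < y'` with `y 0 = 0` gives positivity. -/
theorem pos_of_deriv_gt {y y' : ℝ → ℝ} (h : ∀ t, HasDerivAt y (y' t) t) (k : ℝ) {T : ℝ}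
    (hT : 0 < T) (h0 : y 0 = 0) (hk : ∀ t ∈ Set.Ioo 0 T, k * y t < y' t) : 0 < y T := by
  obtain ⟨ξ, hξ, e⟩ := exists_eq_deriv_mul (hasDerivAt_exp_mul h k) hT
  have h1 : 0 < exp (-(k * ξ)) * (y' ξ - k * y ξ) * (T - 0) :=
    mul_pos (mul_pos (exp_pos _) (sub_pos.2 (hk ξ hξ))) (by linarith)
  rw [← e, h0] at h1
  have h2 : 0 < exp (-(k * T)) * y T := by linarith
  exact pos_of_mul_pos_right h2 (exp_pos _).le

/-- Comparison principle for the operator `(D² - a²)(D² - b²)`: a function vanishing to second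
order at `0` with positive third derivative there cannot tend to `0` at infinity, provided the
operator is nonnegative on it wherever the function is nonnegative. -/
theorem not_tendsto_zero_of_third_deriv_pos {a b : ℝ} {w w1 w2 w3 w4 : ℝ → ℝ}
    (d0 : ∀ t, HasDerivAt w (w1 t) t) (d1 : ∀ t, HasDerivAt w1 (w2 t) t)
    (d2 : ∀ t, HasDerivAt w2 (w3 t) t) (d3 : ∀ t, HasDerivAt w3 (w4 t) t)
    (e0 : w 0 = 0) (e1 : w1 0 = 0) (e2 : w2 0 = 0) (e3 : 0 < w3 0)
    (hG : ∀ t, 0 ≤ w t → 0 ≤ w4 t - (a ^ 2 + b ^ 2) * w2 t + a ^ 2 * b ^ 2 * w t) :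
    ¬ Tendsto w atTop (nhds 0) := by
  have dy1 : ∀ t, HasDerivAt (fun t => w1 t + b * w t) (w2 t + b * w1 t) t := fun t =>
    (d1 t).add ((d0 t).const_mul b)
  have dy2 : ∀ t, HasDerivAt (fun t => w2 t - b ^ 2 * w t) (w3 t - b ^ 2 * w1 t) t := fun t =>
    (d2 t).sub ((d0 t).const_mul _)
  have dy3 : ∀ t, HasDerivAt (fun t => w3 t - b ^ 2 * w1 t + a * (w2 t - b ^ 2 * w t))
      (w4 t - b ^ 2 * w2 t + a * (w3 t - b ^ 2 * w1 t)) t := fun t =>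
    ((d3 t).sub ((d1 t).const_mul _)).add ((dy2 t).const_mul a)
  set y3 : ℝ → ℝ := fun t => w3 t - b ^ 2 * w1 t + a * (w2 t - b ^ 2 * w t) with hy3
  have key : ∀ T, (∀ t ∈ Set.Ioo 0 T, 0 < y3 t) → ∀ t ∈ Set.Ioc 0 T,
      0 < w t ∧ 0 < w2 t - b ^ 2 * w t := by
    intro T h3
    have h2 : ∀ t ∈ Set.Ioc 0 T, 0 < w2 t - b ^ 2 * w t := fun t ht =>
      pos_of_deriv_gt dy2 (-a) ht.1 (by simp [e0, e2]) fun s hs => by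
        have := h3 s ⟨hs.1, hs.2.trans_le ht.2⟩
        simp only [hy3] at this
        linarith
    have h1 : ∀ t ∈ Set.Ioc 0 T, 0 < w1 t + b * w t := fun t ht =>
      pos_of_deriv_gt dy1 b ht.1 (by simp [e0, e1]) fun s hs => by
        have := h2 s ⟨hs.1, hs.2.le.trans ht.2⟩
        linarith
    refine fun t ht => ⟨pos_of_deriv_gt d0 (-b) ht.1 e0 fun s hs => ?_, h2 t ht⟩
    have := h1 s ⟨hs.1, hs.2.le.trans ht.2⟩
    linarith
  have h3 : ∀ t, 0 ≤ t → 0 < y3 t := by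
    by_contra! hcon
    let S : Set ℝ := {t | 0 ≤ t ∧ y3 t ≤ 0}
    have hSc : IsClosed S := by
      have hc : Continuous y3 := continuous_iff_continuousAt.2 fun t => (dy3 t).continuousAt
      exact isClosed_Ici.inter (isClosed_le hc continuous_const)
    have hSb : BddBelow S := ⟨0, fun t ht => ht.1⟩
    have hT := hSc.csInf_mem hcon hSb
    set T := sInf S
    have hlt : ∀ t ∈ Set.Ioo 0 T, 0 < y3 t := by
      intro t ht
      by_contra! hle
      exact absurd (csInf_le hSb (show t ∈ S from ⟨ht.1.le, hle⟩)) (not_le.2 ht.2)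
    refine absurd hT.2 (not_le.2 (pos_of_deriv_ge dy3 a hT.1 ?_ ?_))
    · simpa [hy3, e0, e1, e2] using e3
    · intro t ht
      have := hG t (key T hlt t ⟨ht.1, ht.2.le⟩).1.le
      simp only [hy3]
      linarith
  have hall : ∀ t, 0 < t → 0 < w t ∧ 0 < w2 t - b ^ 2 * w t := fun t ht =>
    key t (fun s hs => h3 s hs.1.le) t ⟨ht, le_rfl⟩
  have hw1 : ∀ t, 0 < t → 0 < w1 t := fun t ht =>
    pos_of_deriv_gt d1 0 ht e1 fun s hs => by
      have := hall s hs.1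
      nlinarith [mul_nonneg (sq_nonneg b) this.1.le]
  intro hlim
  have hle : w 1 ≤ 0 := by
    refine ge_of_tendsto hlim ?_
    filter_upwards [eventually_gt_atTop 1] with t ht
    obtain ⟨ξ, hξ, e⟩ := exists_eq_deriv_mul d0 ht
    have := mul_pos (hw1 ξ (by linarith [hξ.1])) (sub_pos.2 ht)
    linarith
  linarith [(hall 1 one_pos).1]

/-- Uniqueness for a fourth-order linear differential inequality with zero initial data. -/
theorem eq_zero_of_abs_fourth_deriv_le {w w1 w2 w3 w4 : ℝ → ℝ} {K T : ℝ}
    (d0 : ∀ t, HasDerivAt w (w1 t) t) (d1 : ∀ t, HasDerivAt w1 (w2 t) t)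
    (d2 : ∀ t, HasDerivAt w2 (w3 t) t) (d3 : ∀ t, HasDerivAt w3 (w4 t) t)
    (e0 : w 0 = 0) (e1 : w1 0 = 0) (e2 : w2 0 = 0) (e3 : w3 0 = 0) (hK : 0 ≤ K)
    (h4 : ∀ t ∈ Set.Icc 0 T, |w4 t| ≤ K * (|w t| + |w2 t|)) :
    ∀ t ∈ Set.Icc 0 T, w t = 0 := by
  have hd : ∀ t, HasDerivAt (fun t => ((w t, w1 t), (w2 t, w3 t)))
      ((w1 t, w2 t), (w3 t, w4 t)) t := fun t =>
    ((d0 t).prodMk (d1 t)).prodMk ((d2 t).prodMk (d3 t))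
  have := eq_zero_of_abs_deriv_le_mul_abs_self_of_eq_zero_right (K := 1 + 2 * K)
    (fun t _ => (hd t).continuousAt.continuousWithinAt) (fun t _ => (hd t).hasDerivWithinAt)
    (by simp [e0, e1, e2, e3]) (a := 0) (b := T) ?_
  · intro t ht
    have := this t ht
    simp only [Prod.mk_eq_zero] at this
    exact this.1.1
  · intro t ht
    have h := h4 t ⟨ht.1, ht.2.le⟩
    simp only [Prod.norm_def, Real.norm_eq_abs]
    set N := max (max |w t| |w1 t|) (max |w2 t| |w3 t|)
    have n0 : |w t| ≤ N := (le_max_left _ _).trans (le_max_left _ _)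
    have n1 : |w1 t| ≤ N := (le_max_right _ _).trans (le_max_left _ _)
    have n2 : |w2 t| ≤ N := (le_max_left _ _).trans (le_max_right _ _)
    have n3 : |w3 t| ≤ N := (le_max_right _ _).trans (le_max_right _ _)
    have hN : 0 ≤ N := (abs_nonneg _).trans n0
    have hKN : 0 ≤ K * N := mul_nonneg hK hN
    have hb : K * (|w t| + |w2 t|) ≤ K * (N + N) := mul_le_mul_of_nonneg_left (by linarith) hK
    refine max_le (max_le ?_ ?_) (max_le ?_ ?_) <;> linarith

end Differential

section Asymptotics

/-- `φ` is eventually arbitrarily small somewhere on each window of length `L`. -/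
def WindowSmall (φ : ℝ → ℝ) (L : ℝ) : Prop :=
  ∀ ε > 0, ∀ᶠ t in atTop, ∃ ξ ∈ Set.Icc t (t + L), |φ ξ| ≤ ε

theorem tendsto_zero_iff_abs_le {φ : ℝ → ℝ} :
    Tendsto φ atTop (nhds 0) ↔ ∀ ε > 0, ∀ᶠ t in atTop, |φ t| ≤ ε := by
  rw [Metric.tendsto_nhds]
  simp only [Real.dist_eq, sub_zero]
  exact ⟨fun h ε hε => (h ε hε).mono fun _ => le_of_lt,
    fun h ε hε => (h (ε / 2) (half_pos hε)).mono fun _ ht => ht.trans_lt (half_lt_self hε)⟩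

theorem WindowSmall.of_tendsto {φ : ℝ → ℝ} (h : Tendsto φ atTop (nhds 0)) : WindowSmall φ 0 :=
  fun ε hε => (tendsto_zero_iff_abs_le.1 h ε hε).mono fun t ht => ⟨t, by simp, ht⟩

theorem WindowSmall.deriv {φ φ' : ℝ → ℝ} {L : ℝ} (hφ : WindowSmall φ L)
    (d : ∀ t, HasDerivAt φ (φ' t) t) : WindowSmall φ' (2 * L + 1) := by
  intro ε hε
  have h := hφ (ε / 2) (half_pos hε)
  filter_upwards [h, (tendsto_atTop_add_const_right atTop (L + 1) tendsto_id).eventually h]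
    with t ⟨ξ, hξ, h1⟩ ⟨ζ, hζ, h2⟩
  simp only [id] at hζ
  have hd : 1 ≤ ζ - ξ := by linarith [hξ.2, hζ.1]
  obtain ⟨η, hη, e⟩ := exists_eq_deriv_mul d (show ξ < ζ by linarith)
  refine ⟨η, ⟨by linarith [hξ.1, hη.1], by linarith [hζ.2, hη.2]⟩, ?_⟩
  have h3 : |φ' η| * (ζ - ξ) ≤ ε := by
    rw [← abs_of_pos (show 0 < ζ - ξ by linarith), ← abs_mul, ← e]
    linarith [abs_sub (φ ζ) (φ ξ)]
  nlinarith [abs_nonneg (φ' η)]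

theorem WindowSmall.tendsto_of_deriv {φ φ' : ℝ → ℝ} {L : ℝ} (hφ : WindowSmall φ L) (hL : 0 ≤ L)
    (d : ∀ t, HasDerivAt φ (φ' t) t) (h' : Tendsto φ' atTop (nhds 0)) :
    Tendsto φ atTop (nhds 0) := by
  rw [tendsto_zero_iff_abs_le] at h' ⊢
  intro ε hε
  have hδ : 0 < ε / (2 * (L + 1)) := by positivity
  obtain ⟨N, hN⟩ := eventually_atTop.1 (h' _ hδ)
  filter_upwards [hφ (ε / 2) (half_pos hε), eventually_ge_atTop N] with t ⟨ξ, hξ, h1⟩ ht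
  rcases hξ.1.eq_or_lt with rfl | hlt
  · linarith
  obtain ⟨η, hη, e⟩ := exists_eq_deriv_mul d hlt
  have h2 : |φ' η| * (ξ - t) ≤ ε / (2 * (L + 1)) * (L + 1) :=
    mul_le_mul (hN η (by linarith [hη.1])) (by linarith [hξ.2]) (by linarith) hδ.le
  have h3 : ε / (2 * (L + 1)) * (L + 1) = ε / 2 := by field_simp
  have h4 : |φ ξ - φ t| = |φ' η| * (ξ - t) := by
    rw [e, abs_mul, abs_of_pos (sub_pos.2 hlt)]
  have h5 := abs_sub_abs_le_abs_sub (φ t) (φ ξ)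
  rw [abs_sub_comm] at h5
  linarith

/-- If `u → 0` and `u'''' - A u'' → 0` at infinity, then `u', u'', u''' → 0`. -/
theorem tendsto_derivs_zero {A : ℝ} {u u1 u2 u3 u4 : ℝ → ℝ}
    (d0 : ∀ t, HasDerivAt u (u1 t) t) (d1 : ∀ t, HasDerivAt u1 (u2 t) t)
    (d2 : ∀ t, HasDerivAt u2 (u3 t) t) (d3 : ∀ t, HasDerivAt u3 (u4 t) t)
    (hu : Tendsto u atTop (nhds 0)) (h : Tendsto (fun t => u4 t - A * u2 t) atTop (nhds 0)) :
    Tendsto u1 atTop (nhds 0) ∧ Tendsto u2 atTop (nhds 0) ∧ Tendsto u3 atTop (nhds 0) := by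
  have s1 := (WindowSmall.of_tendsto hu).deriv d0
  have s2 := s1.deriv d1
  have dh : ∀ t, HasDerivAt (fun t => u2 t - A * u t) (u3 t - A * u1 t) t := fun t =>
    (d2 t).sub ((d0 t).const_mul A)
  have dh' : ∀ t, HasDerivAt (fun t => u3 t - A * u1 t) (u4 t - A * u2 t) t := fun t =>
    (d3 t).sub ((d1 t).const_mul A)
  have hAu : Tendsto (fun t => A * u t) atTop (nhds 0) := by simpa using hu.const_mul A
  have sh : WindowSmall (fun t => u2 t - A * u t) (2 * (2 * 0 + 1) + 1) := by
    intro ε hε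
    obtain ⟨N, hN⟩ := eventually_atTop.1 (tendsto_zero_iff_abs_le.1 hAu _ (half_pos hε))
    filter_upwards [s2 (ε / 2) (half_pos hε), eventually_ge_atTop N] with t ⟨ξ, hξ, h1⟩ ht
    exact ⟨ξ, hξ, by linarith [abs_sub (u2 ξ) (A * u ξ), hN ξ (ht.trans hξ.1)]⟩
  have t1 := (sh.deriv dh).tendsto_of_deriv (by norm_num) dh' h
  have t0 := sh.tendsto_of_deriv (by norm_num) dh t1
  have l2 : Tendsto u2 atTop (nhds 0) := by simpa using t0.add hAu
  have l1 := s1.tendsto_of_deriv (by norm_num) d1 l2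
  exact ⟨l1, l2, by simpa using t1.add (l1.const_mul A)⟩

end Asymptotics

section Symmetry

/-- A positive solution of `u'''' - (a² + b²) u'' + a² b² u = g(u)`, with `g` nondecreasing and
locally Lipschitz, that vanishes at infinity is symmetric about each of its critical points. -/
theorem symmetric_of_deriv_eq_zero {a b : ℝ} {g : ℝ → ℝ} {u u1 u2 u3 u4 : ℝ → ℝ}
    (d0 : ∀ t, HasDerivAt u (u1 t) t) (d1 : ∀ t, HasDerivAt u1 (u2 t) t)
    (d2 : ∀ t, HasDerivAt u2 (u3 t) t) (d3 : ∀ t, HasDerivAt u3 (u4 t) t)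
    (hode : ∀ t, u4 t - (a ^ 2 + b ^ 2) * u2 t + a ^ 2 * b ^ 2 * u t = g (u t))
    (hpos : ∀ t, 0 < u t) (htop : Tendsto u atTop (nhds 0)) (hbot : Tendsto u atBot (nhds 0))
    (hmono : ∀ x y, 0 < x → x ≤ y → g x ≤ g y)
    (hlip : ∀ M, ∃ K, ∀ x y, 0 < x → 0 < y → x ≤ M → y ≤ M → |g x - g y| ≤ K * |x - y|)
    {c : ℝ} (hc : u1 c = 0) (t : ℝ) : u (c + t) = u (c - t) := by
  have D : ∀ {y y' : ℝ → ℝ}, (∀ t, HasDerivAt y (y' t) t) → ∀ t,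
      HasDerivAt (fun t => y (c + t)) (y' (c + t)) t ∧
      HasDerivAt (fun t => y (c - t)) (-y' (c - t)) t := fun h t =>
    ⟨(h (c + t)).comp_const_add c t, (h (c - t)).comp_const_sub c t⟩
  have D0 : ∀ t, HasDerivAt (fun t => u (c + t) - u (c - t)) (u1 (c + t) + u1 (c - t)) t :=
    fun t => ((D d0 t).1.sub (D d0 t).2).congr_deriv (by ring)
  have D1 : ∀ t, HasDerivAt (fun t => u1 (c + t) + u1 (c - t)) (u2 (c + t) - u2 (c - t)) t :=
    fun t => (D d1 t).1.add (D d1 t).2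
  have D2 : ∀ t, HasDerivAt (fun t => u2 (c + t) - u2 (c - t)) (u3 (c + t) + u3 (c - t)) t :=
    fun t => ((D d2 t).1.sub (D d2 t).2).congr_deriv (by ring)
  have D3 : ∀ t, HasDerivAt (fun t => u3 (c + t) + u3 (c - t)) (u4 (c + t) - u4 (c - t)) t :=
    fun t => (D d3 t).1.add (D d3 t).2
  have hlim : Tendsto (fun t => u (c + t) - u (c - t)) atTop (nhds 0) := by
    have hl := htop.comp (tendsto_atTop_add_const_left atTop c tendsto_id)
    have hr := hbot.comp (tendsto_atBot_add_const_left atTop c tendsto_neg_atTop_atBot)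
    simpa [Function.comp_def, sub_eq_add_neg] using hl.sub hr
  have h3 : u3 c = 0 := by
    rcases lt_trichotomy (u3 c) 0 with hneg | h | hgt
    · refine absurd (by simpa [Pi.neg_def] using hlim.neg) (not_tendsto_zero_of_third_deriv_pos (a := a)
        (b := b) (fun t => (D0 t).neg) (fun t => (D1 t).neg) (fun t => (D2 t).neg)
        (fun t => (D3 t).neg) (by simp) (by simp [hc]) (by simp) (by simp; linarith) ?_)
      intro t ht
      have := hmono (u (c + t)) (u (c - t)) (hpos _) (by simp at ht; linarith)
      rw [← hode, ← hode] at this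
      simp only [Pi.neg_apply]
      linarith
    · exact h
    · refine absurd hlim (not_tendsto_zero_of_third_deriv_pos (a := a)
        (b := b) D0 D1 D2 D3 (by simp) (by simp [hc]) (by simp) (by simp; linarith) ?_)
      intro t ht
      have := hmono (u (c - t)) (u (c + t)) (hpos _) (by linarith)
      rw [← hode, ← hode] at this
      linarith
  have main : ∀ T, 0 ≤ T → u (c + T) = u (c - T) := by
    intro T hT
    have hcont : Continuous u := continuous_iff_continuousAt.2 fun t => (d0 t).continuousAt
    obtain ⟨M, hM⟩ := (isCompact_Icc (a := c - T) (b := c + T)).bddAbove_image hcont.continuousOn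
    have hM' : ∀ s ∈ Set.Icc (c - T) (c + T), u s ≤ M := fun s hs =>
      hM (Set.mem_image_of_mem u hs)
    obtain ⟨K, hK⟩ := hlip M
    refine sub_eq_zero.1 (eq_zero_of_abs_fourth_deriv_le
      (K := |K| + (a ^ 2 + b ^ 2) + a ^ 2 * b ^ 2) D0 D1 D2 D3 (by simp) (by simp [hc])
      (by simp) (by simp [h3]) (by positivity) ?_ T ⟨hT, le_rfl⟩)
    intro t ht
    have hg := hK (u (c + t)) (u (c - t)) (hpos _) (hpos _)
      (hM' _ ⟨by linarith [ht.1], by linarith [ht.2]⟩)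
      (hM' _ ⟨by linarith [ht.2], by linarith [ht.1]⟩)
    set W := u (c + t) - u (c - t) with hW
    set W2 := u2 (c + t) - u2 (c - t) with hW2
    have e : u4 (c + t) - u4 (c - t) =
        (g (u (c + t)) - g (u (c - t))) + (a ^ 2 + b ^ 2) * W2 - a ^ 2 * b ^ 2 * W := by
      rw [← hode, ← hode, hW, hW2]
      ring
    have i1 : |(a ^ 2 + b ^ 2) * W2| = (a ^ 2 + b ^ 2) * |W2| := by
      rw [abs_mul, abs_of_nonneg (by positivity)]
    have i2 : |a ^ 2 * b ^ 2 * W| = a ^ 2 * b ^ 2 * |W| := by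
      rw [abs_mul, abs_of_nonneg (by positivity)]
    have i3 : K * |W| ≤ |K| * |W| := mul_le_mul_of_nonneg_right (le_abs_self K) (abs_nonneg W)
    have j1 : 0 ≤ (a ^ 2 + b ^ 2) * |W| := by positivity
    have j2 : 0 ≤ a ^ 2 * b ^ 2 * |W2| := by positivity
    have j3 : 0 ≤ |K| * |W2| := by positivity
    rw [e]
    have k1 := abs_sub (g (u (c + t)) - g (u (c - t)) + (a ^ 2 + b ^ 2) * W2) (a ^ 2 * b ^ 2 * W)
    have k2 := abs_add_le (g (u (c + t)) - g (u (c - t))) ((a ^ 2 + b ^ 2) * W2)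
    linarith
  rcases le_total 0 t with ht | ht
  · exact main t ht
  · simpa [← sub_eq_add_neg] using (main (-t) (by linarith)).symm

/-- A positive function vanishing at infinity has at most one centre of symmetry. -/
theorem center_unique {u : ℝ → ℝ} (hpos : ∀ t, 0 < u t) (htop : Tendsto u atTop (nhds 0))
    {c d : ℝ} (hc : ∀ t, u (c + t) = u (c - t)) (hd : ∀ t, u (d + t) = u (d - t)) : c = d := by
  have key : ∀ c d : ℝ, (∀ t, u (c + t) = u (c - t)) → (∀ t, u (d + t) = u (d - t)) →
      ¬ c < d := by
    intro c d hc hd hlt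
    have hper : Function.Periodic u (2 * (d - c)) := by
      intro t
      have h1 := hd (t + d - 2 * c)
      have h2 := hc (c - t)
      rw [show d + (t + d - 2 * c) = t + 2 * (d - c) by ring,
        show d - (t + d - 2 * c) = c + (c - t) by ring, h2] at h1
      simpa using h1
    have hk : Tendsto (fun k : ℕ => (k : ℝ) * (2 * (d - c))) atTop atTop :=
      tendsto_natCast_atTop_atTop.atTop_mul_const (by linarith)
    have hl := htop.comp hk
    have he : (u ∘ fun k : ℕ => (k : ℝ) * (2 * (d - c))) = fun _ => u 0 := by
      funext k
      simpa using hper.nat_mul k 0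
    rw [he] at hl
    exact (hpos 0).ne' (tendsto_nhds_unique tendsto_const_nhds hl)
  exact le_antisymm (not_lt.1 (key d c hd hc)) (not_lt.1 (key c d hc hd))

end Symmetry

section Nonlinearity

theorem abs_rpow_mul_eq {q x : ℝ} (hx : 0 < x) : |x| ^ (q - 1) * x = x ^ q := by
  rw [abs_of_pos hx, rpow_sub_one hx.ne', div_mul_cancel₀ _ hx.ne']

theorem abs_rpow_sub_rpow_le {q : ℝ} (hq : 1 ≤ q) {M x y : ℝ} (hx : 0 < x) (hy : 0 < y)
    (hxM : x ≤ M) (hyM : y ≤ M) : |x ^ q - y ^ q| ≤ q * M ^ (q - 1) * |x - y| := by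
  refine (convex_Icc (0 : ℝ) M).norm_image_sub_le_of_norm_hasDerivWithin_le
    (f := fun s => s ^ q) (fun s _ => (hasDerivAt_rpow_const (Or.inr hq)).hasDerivWithinAt)
    (fun s hs => ?_) ⟨hy.le, hyM⟩ ⟨hx.le, hxM⟩
  rw [Real.norm_eq_abs, abs_of_nonneg (mul_nonneg (by linarith) (rpow_nonneg hs.1 _))]
  exact mul_le_mul_of_nonneg_left (rpow_le_rpow hs.1 hs.2 (by linarith)) (by linarith)

theorem one_lt_p {n : ℕ} (hn : 5 ≤ n) : 1 < p n := by
  have h : (5 : ℝ) ≤ n := by exact_mod_cast hn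
  rw [p, lt_div_iff₀ (by linarith)]
  linarith

theorem hasDerivAt_F_comp {n : ℕ} (hn : 5 ≤ n) {v : ℝ → ℝ} (hpos : ∀ t, 0 < v t) {v' t : ℝ}
    (h : HasDerivAt v v' t) : HasDerivAt (fun s => F n (v s)) (f n (v t) * v') t := by
  have hp := one_lt_p hn
  have h1 : HasDerivAt (fun s => v s ^ (p n + 1) / (p n + 1) - B n / 2 * v s ^ 2)
      (v' * (p n + 1) * v t ^ (p n + 1 - 1) / (p n + 1) - B n / 2 * (2 * v t ^ 1 * v')) t :=
    ((h.rpow_const (Or.inr (by linarith))).div_const _).sub ((h.pow 2).const_mul _)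
  have e : (fun s => F n (v s)) = fun s => v s ^ (p n + 1) / (p n + 1) - B n / 2 * v s ^ 2 := by
    funext s
    rw [F, abs_of_pos (hpos s)]
  rw [e]
  convert h1 using 1
  have : p n + 1 ≠ 0 := by linarith
  rw [f, abs_rpow_mul_eq (hpos t), add_sub_cancel_right]
  field_simp

theorem tendsto_f_zero {n : ℕ} (hn : 5 ≤ n) : Tendsto (f n) (nhds 0) (nhds 0) := by
  have hp := one_lt_p hn
  have hc : Continuous (f n) := by
    have : Continuous fun s : ℝ => |s| ^ (p n - 1) :=
      continuous_abs.rpow_const fun _ => Or.inr (by linarith)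
    unfold f
    fun_prop
  simpa [f] using hc.tendsto 0

theorem tendsto_F_zero {n : ℕ} (hn : 5 ≤ n) : Tendsto (F n) (nhds 0) (nhds 0) := by
  have hp := one_lt_p hn
  have hc : Continuous (F n) := by
    have : Continuous fun s : ℝ => |s| ^ (p n + 1) :=
      continuous_abs.rpow_const fun _ => Or.inr (by linarith)
    unfold F
    fun_prop
  have h0 : F n 0 = 0 := by simp [F, zero_rpow (show p n + 1 ≠ 0 by linarith)]
  simpa [h0] using hc.tendsto 0

end Nonlinearity

end Paper

/-- For a positive `C⁴` solution `v` of `v'''' - A v'' - f(v) = 0` with `v → 0` at `±∞` and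
`v'(0) = 0`: `0` is the only critical point, `v' < 0` on `(0,∞)`, and the energy vanishes. -/
theorem homoclinic_properties (n : ℕ) (hn : 5 ≤ n) (v : ℝ → ℝ)
    (hreg : ContDiff ℝ 4 v)
    (hode : ∀ t : ℝ, iteratedDeriv 4 v t - Paper.A n * iteratedDeriv 2 v t
      - Paper.f n (v t) = 0)
    (hpos : ∀ t : ℝ, 0 < v t)
    (hlim : Tendsto v atTop (nhds 0) ∧ Tendsto v atBot (nhds 0))
    (hcrit : deriv v 0 = 0) :
    (∀ t : ℝ, deriv v t = 0 → t = 0) ∧ (∀ t : ℝ, 0 < t → deriv v t < 0) ∧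
    ∀ t : ℝ, Paper.E n v t = 0 := by
  have hp := Paper.one_lt_p hn
  have d : ∀ m : ℕ, m < 4 → ∀ t,
      HasDerivAt (iteratedDeriv m v) (iteratedDeriv (m + 1) v t) t := by
    intro m hm t
    rw [iteratedDeriv_succ]
    exact (hreg.differentiable_iteratedDeriv m (by exact_mod_cast hm) t).hasDerivAt
  have d0 : ∀ t, HasDerivAt v (deriv v t) t := by
    simpa [iteratedDeriv_zero, iteratedDeriv_one] using d 0 (by norm_num)
  have d1 : ∀ t, HasDerivAt (deriv v) (iteratedDeriv 2 v t) t := by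
    simpa [iteratedDeriv_one] using d 1 (by norm_num)
  have d2 := d 2 (by norm_num)
  have d3 := d 3 (by norm_num)
  simp only [Nat.reduceAdd] at d2 d3
  have hsym : ∀ c, deriv v c = 0 → ∀ t, v (c + t) = v (c - t) := fun c hc =>
    Paper.symmetric_of_deriv_eq_zero (a := n / 2) (b := (n - 4) / 2) (g := fun s => s ^ Paper.p n)
      d0 d1 d2 d3
      (fun t => by
        have h := hode t
        rw [Paper.f, Paper.abs_rpow_mul_eq (hpos t), Paper.A, Paper.B] at h
        linear_combination h)
      hpos hlim.1 hlim.2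
      (fun x y hx hxy => rpow_le_rpow hx.le hxy (by linarith))
      (fun M => ⟨_, fun x y hx hy => Paper.abs_rpow_sub_rpow_le hp.le hx hy⟩) hc
  have huniq : ∀ t, deriv v t = 0 → t = 0 := fun t ht =>
    Paper.center_unique hpos hlim.1 (hsym t ht) (hsym 0 hcrit)
  refine ⟨huniq, ?_, ?_⟩
  · intro t ht
    by_contra! hge
    have hcont : Continuous (deriv v) :=
      continuous_iff_continuousAt.2 fun t => (d1 t).continuousAt
    have hall : ∀ s, t ≤ s → 0 < deriv v s := by
      intro s hs
      by_contra! hle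
      obtain ⟨r, hr, hr0⟩ := intermediate_value_Icc' hs hcont.continuousOn ⟨hle, hge⟩
      linarith [huniq r hr0, hr.1]
    have : v t ≤ 0 := by
      refine ge_of_tendsto hlim.1 ?_
      filter_upwards [eventually_gt_atTop t] with s hs
      obtain ⟨ξ, hξ, e⟩ := Paper.exists_eq_deriv_mul d0 hs
      have := mul_pos (hall ξ hξ.1.le) (sub_pos.2 hs)
      linarith
    linarith [hpos t]
  · have dE : ∀ t, HasDerivAt (Paper.E n v) 0 t := by
      intro t
      have h := (((d3 t).neg.mul (d1 t)).add (((d2 t).pow 2).const_mul (1 / 2))).add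
        (((d1 t).pow 2).const_mul (Paper.A n / 2)) |>.add
        (Paper.hasDerivAt_F_comp hn hpos (d0 t))
      refine h.congr_deriv ?_
      simp only [Pi.neg_apply]
      push_cast
      linear_combination -(deriv v t) * hode t
    have hf := (Paper.tendsto_f_zero hn).comp hlim.1
    obtain ⟨l1, l2, l3⟩ := Paper.tendsto_derivs_zero (A := Paper.A n) d0 d1 d2 d3 hlim.1
      (hf.congr fun t => by simp only [Function.comp]; linarith [hode t])
    have hE : Tendsto (Paper.E n v) atTop (nhds 0) := by
      have := (((l3.neg.mul l1).add ((l2.pow 2).const_mul (1 / 2))).add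
        ((l1.pow 2).const_mul (Paper.A n / 2))).add ((Paper.tendsto_F_zero hn).comp hlim.1)
      have e : Paper.E n v = fun t => -(iteratedDeriv 3 v t) * deriv v t
          + 1 / 2 * (iteratedDeriv 2 v t) ^ 2 + Paper.A n / 2 * (deriv v t) ^ 2
          + Paper.F n (v t) := rfl
      rw [e]
      simpa using this
    intro t
    have hconst : Paper.E n v = fun _ => Paper.E n v t := by
      funext s
      exact is_const_of_deriv_eq_zero (fun x => (dE x).differentiableAt)
        (fun x => (dE x).deriv) s t
    rw [hconst] at hE
    exact tendsto_nhds_unique tendsto_const_nhds hE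
end

section
/- Let n ≥ 5 and let v ∈ C⁴(ℝ) be a positive solution of the ODE v'''' − A·v'' − f(v) = 0 on ℝ. Then the function u defined on ℝⁿ \ {0} by u(x) = |x|^(−(n−4)/2)·v(ln|x|) is a positive C⁴ function satisfying the biharmonic equation Δ²u = u^((n+4)/(n−4)) on ℝⁿ \ {0}. -/
open Real Filter

namespace Paper

/-- The Laplacian of `u : ℝⁿ → ℝ` at `x`, as the sum of the second derivatives of `u` along
the coordinate directions. -/
noncomputable def lap (n : ℕ) (u : EuclideanSpace ℝ (Fin n) → ℝ)
    (x : EuclideanSpace ℝ (Fin n)) : ℝ :=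
  ∑ i : Fin n,
    iteratedDeriv 2 (fun s : ℝ => u (x + s • EuclideanSpace.single i (1 : ℝ))) 0

/-- The bi-Laplacian `Δ² = Δ ∘ Δ`. -/
noncomputable def biLap (n : ℕ) (u : EuclideanSpace ℝ (Fin n) → ℝ)
    (x : EuclideanSpace ℝ (Fin n)) : ℝ :=
  lap n (lap n u) x

end Paper

/-- Derivative along a line of a radial function in Emden-Fowler form. -/
lemma hasDerivAt_norm_rpow_mul_comp_log {V : Type*} [NormedAddCommGroup V]
    [InnerProductSpace ℝ V] (a : ℝ) {w : ℝ → ℝ} {w' : ℝ} (x e : V) (s : ℝ)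
    (hx : x + s • e ≠ 0) (hw : HasDerivAt w w' (Real.log ‖x + s • e‖)) :
    HasDerivAt (fun s : ℝ => ‖x + s • e‖ ^ a * w (Real.log ‖x + s • e‖))
      (‖x + s • e‖ ^ (a - 2) * (a * w (Real.log ‖x + s • e‖) + w') * inner ℝ (x + s • e) e) s := by
  have hr : 0 < ‖x + s • e‖ := norm_pos_iff.2 hx
  have hline : HasDerivAt (fun s : ℝ => x + s • e) e s := by
    simpa using ((hasDerivAt_id s).smul_const e).const_add x
  have hnorm : HasDerivAt (fun s : ℝ => ‖x + s • e‖) (inner ℝ (x + s • e) e / ‖x + s • e‖) s := by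
    have h := hline.norm_sq.sqrt (by positivity)
    simp only [Real.sqrt_sq (norm_nonneg _)] at h
    convert h using 1
    field_simp
  have hlog := hnorm.log hr.ne'
  refine ((hnorm.rpow_const (p := a) (Or.inl hr.ne')).mul (hw.comp s hlog)).congr_deriv ?_
  simp only [Function.comp_apply, Real.rpow_sub hr, Real.rpow_one, Real.rpow_two]
  field_simp

/-- The Laplacian of a radial function in Emden-Fowler form. -/
lemma lap_eq_of_eq_norm_rpow_mul_comp_log {n : ℕ} (a : ℝ) {w w₁ w₂ : ℝ → ℝ}
    (hw : ∀ t, HasDerivAt w (w₁ t) t) (hw₁ : ∀ t, HasDerivAt w₁ (w₂ t) t)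
    {u : EuclideanSpace ℝ (Fin n) → ℝ}
    (hu : ∀ y, y ≠ 0 → u y = ‖y‖ ^ a * w (Real.log ‖y‖))
    {x : EuclideanSpace ℝ (Fin n)} (hx : x ≠ 0) :
    Paper.lap n u x = ‖x‖ ^ (a - 2) * (w₂ (Real.log ‖x‖) + (2 * a + n - 2) * w₁ (Real.log ‖x‖)
      + a * (a + n - 2) * w (Real.log ‖x‖)) := by
  have hr : 0 < ‖x‖ := norm_pos_iff.2 hx
  set t := Real.log ‖x‖ with ht
  set g : ℝ → ℝ := fun t => a * w t + w₁ t with hg_def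
  have hg : ∀ t, HasDerivAt g (a * w₁ t + w₂ t) t := fun t => ((hw t).const_mul a).add (hw₁ t)
  have hdir : ∀ i : Fin n,
      iteratedDeriv 2 (fun s : ℝ => u (x + s • EuclideanSpace.single i (1 : ℝ))) 0
        = ‖x‖ ^ (a - 4) * ((a - 2) * g t + (a * w₁ t + w₂ t)) * x i ^ 2
          + ‖x‖ ^ (a - 2) * g t := by
    intro i
    set e : EuclideanSpace ℝ (Fin n) := EuclideanSpace.single i (1 : ℝ) with he
    have hne : ∀ᶠ s : ℝ in nhds 0, x + s • e ≠ 0 := by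
      have hc : Continuous fun s : ℝ => x + s • e := by fun_prop
      exact hc.continuousAt.eventually_ne (by simpa using hx)
    have hfirst : deriv (fun s : ℝ => u (x + s • e)) =ᶠ[nhds 0] fun s : ℝ =>
        ‖x + s • e‖ ^ (a - 2) * g (Real.log ‖x + s • e‖) * inner ℝ (x + s • e) e := by
      filter_upwards [hne.eventually_nhds] with s hs
      have heq : (fun s : ℝ => u (x + s • e)) =ᶠ[nhds s]
          fun s : ℝ => ‖x + s • e‖ ^ a * w (Real.log ‖x + s • e‖) := hs.mono fun s hs => hu _ hs
      rw [heq.deriv_eq]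
      exact (hasDerivAt_norm_rpow_mul_comp_log a x e s hs.self_of_nhds (hw _)).deriv
    have hinner : HasDerivAt (fun s : ℝ => inner ℝ (x + s • e) e) 1 0 := by
      have h : (fun s : ℝ => inner ℝ (x + s • e) e) = fun s => x i + s := by
        funext s
        simp [he, inner_add_left, inner_smul_left, EuclideanSpace.inner_single_right]
      rw [h]
      exact (hasDerivAt_id (0 : ℝ)).const_add (x i)
    have hsecond := (hasDerivAt_norm_rpow_mul_comp_log (a - 2) x e 0 (by simpa using hx)
      (hg _)).mul hinner
    rw [iteratedDeriv_succ, iteratedDeriv_one, hfirst.deriv_eq]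
    refine hsecond.deriv.trans ?_
    have hxe : inner ℝ x e = x i := by simp [he, EuclideanSpace.inner_single_right]
    rw [zero_smul, add_zero, hxe, show a - 2 - 2 = a - 4 by ring]
    ring
  have hsum : ∑ i, x i ^ 2 = ‖x‖ ^ 2 := (EuclideanSpace.real_norm_sq_eq x).symm
  have hpow : ‖x‖ ^ (a - 4) * ‖x‖ ^ 2 = ‖x‖ ^ (a - 2) := by
    rw [← Real.rpow_two, ← Real.rpow_add hr]
    ring_nf
  rw [Paper.lap, Finset.sum_congr rfl fun i _ => hdir i, Finset.sum_add_distrib,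
    ← Finset.mul_sum, hsum, Finset.sum_const, Finset.card_univ, Fintype.card_fin, nsmul_eq_mul,
    mul_right_comm, hpow, hg_def]
  ring

/-- Every positive `C⁴` solution `v` of the ODE `v'''' - A v'' - f(v) = 0` gives rise, via
`u(x) = |x|^(-(n-4)/2) v(ln|x|)`, to a positive `C⁴` solution of the biharmonic equation
`Δ²u = u^((n+4)/(n-4))` on `ℝⁿ \ {0}`. -/
theorem ode_solution_gives_biharmonic (n : ℕ) (hn : 5 ≤ n) (v : ℝ → ℝ)
    (hreg : ContDiff ℝ 4 v) (hpos : ∀ t : ℝ, 0 < v t)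
    (hode : ∀ t : ℝ, iteratedDeriv 4 v t - Paper.A n * iteratedDeriv 2 v t
      - Paper.f n (v t) = 0) :
    (∀ x : EuclideanSpace ℝ (Fin n), x ≠ 0 →
      0 < ‖x‖ ^ (-(((n : ℝ) - 4) / 2)) * v (Real.log ‖x‖)) ∧
    ContDiffOn ℝ 4
      (fun x : EuclideanSpace ℝ (Fin n) => ‖x‖ ^ (-(((n : ℝ) - 4) / 2)) * v (Real.log ‖x‖))
      {x | x ≠ 0} ∧
    ∀ x : EuclideanSpace ℝ (Fin n), x ≠ 0 →
      Paper.biLap n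
        (fun y : EuclideanSpace ℝ (Fin n) => ‖y‖ ^ (-(((n : ℝ) - 4) / 2)) * v (Real.log ‖y‖)) x
      = (‖x‖ ^ (-(((n : ℝ) - 4) / 2)) * v (Real.log ‖x‖)) ^ (((n : ℝ) + 4) / ((n : ℝ) - 4)) := by
  have hn' : (0 : ℝ) < (n : ℝ) - 4 := by
    have : (5 : ℝ) ≤ n := by exact_mod_cast hn
    linarith
  refine ⟨fun x hx => mul_pos (Real.rpow_pos_of_pos (norm_pos_iff.2 hx) _) (hpos _), ?_, ?_⟩
  · intro x hx
    have hnorm : ContDiffAt ℝ 4 (fun y : EuclideanSpace ℝ (Fin n) => ‖y‖) x := contDiffAt_norm ℝ hx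
    have hne : ‖x‖ ≠ 0 := norm_ne_zero_iff.2 hx
    exact ((hnorm.rpow_const_of_ne hne).mul
      (hreg.contDiffAt.comp x (hnorm.log hne))).contDiffWithinAt
  · intro x hx
    have hr : 0 < ‖x‖ := norm_pos_iff.2 hx
    have hderiv : ∀ k : ℕ, k < 4 → ∀ t,
        HasDerivAt (iteratedDeriv k v) (iteratedDeriv (k + 1) v t) t := by
      intro k hk t
      rw [iteratedDeriv_succ]
      exact (hreg.differentiable_iteratedDeriv k (by exact_mod_cast hk) t).hasDerivAt
    have h0 : ∀ t, HasDerivAt v (iteratedDeriv 1 v t) t := by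
      simpa using hderiv 0 (by norm_num)
    have h1 := hderiv 1 (by norm_num)
    have h2 := hderiv 2 (by norm_num)
    have h3 := hderiv 3 (by norm_num)
    set a : ℝ := -(((n : ℝ) - 4) / 2) with ha
    have hinner := fun y (hy : y ≠ 0) => lap_eq_of_eq_norm_rpow_mul_comp_log (n := n) a h0 h1
      (u := fun y => ‖y‖ ^ a * v (Real.log ‖y‖)) (fun _ _ => rfl) (x := y) hy
    rw [Paper.biLap, lap_eq_of_eq_norm_rpow_mul_comp_log (a - 2)
      (fun t => ((h2 t).add ((h1 t).const_mul _)).add ((h0 t).const_mul _))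
      (fun t => ((h3 t).add ((h2 t).const_mul _)).add ((h1 t).const_mul _)) hinner hx]
    set t := Real.log ‖x‖
    have hv := hpos t
    have hode' : iteratedDeriv 4 v t = Paper.A n * iteratedDeriv 2 v t
        + (v t ^ (((n : ℝ) + 4) / ((n : ℝ) - 4)) - Paper.B n * v t) := by
      have h := hode t
      have hf : Paper.f n (v t) = v t ^ (((n : ℝ) + 4) / ((n : ℝ) - 4)) - Paper.B n * v t := by
        rw [Paper.f, Paper.p, abs_of_pos hv, Real.rpow_sub_one hv.ne', div_mul_cancel₀ _ hv.ne']
      linarith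
    have hexp : a * (((n : ℝ) + 4) / ((n : ℝ) - 4)) = a - 2 - 2 := by
      rw [ha]
      field_simp
      ring
    rw [Real.mul_rpow (by positivity) hv.le, ← Real.rpow_mul hr.le, hexp]
    congr 1
    norm_num [hode', Paper.A, Paper.B, ha]
    ring
end
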